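/- arXiv:2008.07285 — 3 statements merged into one kernel-verified Lean document; each statement's English description precedes it below -/
import Mathlib

section
/- There exist ε > 0 and continuous functions x₁, x₂, y₂, x₃, y₃, z₃ : (1−ε, 1+ε) → ℝ such that, writing y₁(t) = t, one has (x₁(1), y₁(1), x₂(1), y₂(1), x₃(1), y₃(1), z₃(1)) = (2, 1, 2, 2, 1, 1, 1), and for every t ∈ (1−ε, 1+ε) the seven equations x₁(t)² + y₁(t)² = 5, (x₂(t)−1)² + y₂(t)² = 5, (x₂(t)−x₁(t))² + (y₂(t)−y₁(t))² = 1, x₃(t)² + y₃(t)² + z₃(t)² = 3, (x₃(t)−1)² + y₃(t)² + z₃(t)² = 2, (x₃(t)−x₁(t))² + (y₃(t)−y₁(t))² + z₃(t)² = 2, (x₃(t)−x₂(t))² + (y₃(t)−y₂(t))² + z₃(t)² = 3 all hold. Since y₁(t) = t is nonconstant, this family is a nonconstant deformation with all eight edge lengths fixed. -/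
/-- Reflecting `A` in the mirror of `B` and `D` gives `C`, and placing `E` on that mirror with
`x₃ = 1` gives the five edge lengths at `C` and `E` that remain to be checked. -/
theorem antiparallelogram_pyramid_lengths {x t y z : ℝ} (ht : t ≠ 0) (hx : 3 - x ≠ 0)
    (hxt : x ^ 2 + t ^ 2 = 5) (hy : y = (3 - x) / t) (hz : z ^ 2 = 2 - y ^ 2) :
    (2 * (x - 1) / (3 - x) - 1) ^ 2 + (2 * t / (3 - x)) ^ 2 = 5 ∧
    (2 * (x - 1) / (3 - x) - x) ^ 2 + (2 * t / (3 - x) - t) ^ 2 = 1 ∧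
    1 ^ 2 + y ^ 2 + z ^ 2 = 3 ∧
    (1 - 1) ^ 2 + y ^ 2 + z ^ 2 = 2 ∧
    (1 - x) ^ 2 + (y - t) ^ 2 + z ^ 2 = 2 ∧
    (1 - 2 * (x - 1) / (3 - x)) ^ 2 + (y - 2 * t / (3 - x)) ^ 2 + z ^ 2 = 3 := by
  have hyt : y * t = 3 - x := by rw [hy]; field_simp
  have htt : t ^ 2 = 5 - x ^ 2 := by linarith
  refine ⟨?_, ?_, by linarith, by linarith, by linear_combination hz + hxt - 2 * hyt, ?_⟩
  · field_simp
    rw [htt]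
    ring
  · field_simp
    linear_combination (x - 1) ^ 2 * hxt
  · have hlen : (2 * (x - 1) / (3 - x)) ^ 2 + (2 * t / (3 - x)) ^ 2 = 8 / (3 - x) := by
      field_simp
      linear_combination 4 * hxt
    have hdot : 2 * (x - 1) / (3 - x) + y * (2 * t / (3 - x)) = 4 / (3 - x) := by
      field_simp
      linear_combination 2 * hyt
    linear_combination hlen - 2 * hdot + hz


/-- **Strong flexibility of a self-intersecting quadrangular pyramid.**
There is a nonconstant continuous family, parametrized by `y₁ = t` near `1`,
of configurations `D = (x₁,t,0)`, `C = (x₂,y₂,0)`, `E = (x₃,y₃,z₃)` (with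
`A = (0,0,0)`, `B = (1,0,0)` fixed) passing through the pyramid
`A=(0,0,0), B=(1,0,0), C=(2,2,0), D=(2,1,0), E=(1,1,1)` at `t = 1` and
preserving all eight squared edge lengths. -/
theorem selfintersecting_pyramid_strongly_flexible :
    ∃ ε : ℝ, 0 < ε ∧
      ∃ x₁ x₂ y₂ x₃ y₃ z₃ : ℝ → ℝ,
        ContinuousOn x₁ (Set.Ioo (1 - ε) (1 + ε)) ∧
        ContinuousOn x₂ (Set.Ioo (1 - ε) (1 + ε)) ∧
        ContinuousOn y₂ (Set.Ioo (1 - ε) (1 + ε)) ∧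
        ContinuousOn x₃ (Set.Ioo (1 - ε) (1 + ε)) ∧
        ContinuousOn y₃ (Set.Ioo (1 - ε) (1 + ε)) ∧
        ContinuousOn z₃ (Set.Ioo (1 - ε) (1 + ε)) ∧
        x₁ 1 = 2 ∧ x₂ 1 = 2 ∧ y₂ 1 = 2 ∧ x₃ 1 = 1 ∧ y₃ 1 = 1 ∧ z₃ 1 = 1 ∧
        ∀ t ∈ Set.Ioo (1 - ε) (1 + ε),
          (x₁ t) ^ 2 + t ^ 2 = 5 ∧
          (x₂ t - 1) ^ 2 + (y₂ t) ^ 2 = 5 ∧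
          (x₂ t - x₁ t) ^ 2 + (y₂ t - t) ^ 2 = 1 ∧
          (x₃ t) ^ 2 + (y₃ t) ^ 2 + (z₃ t) ^ 2 = 3 ∧
          (x₃ t - 1) ^ 2 + (y₃ t) ^ 2 + (z₃ t) ^ 2 = 2 ∧
          (x₃ t - x₁ t) ^ 2 + (y₃ t - t) ^ 2 + (z₃ t) ^ 2 = 2 ∧
          (x₃ t - x₂ t) ^ 2 + (y₃ t - y₂ t) ^ 2 + (z₃ t) ^ 2 = 3 := by
  have hlow : ∀ t ∈ Set.Ioo (1 - 1 / 10 : ℝ) (1 + 1 / 10), 19 / 10 ≤ √(5 - t ^ 2) := by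
    rintro t ⟨h₁, h₂⟩
    apply Real.le_sqrt_of_sq_le
    nlinarith
  have hupp : ∀ t : ℝ, √(5 - t ^ 2) < 3 := by
    intro t
    rw [Real.sqrt_lt' (by norm_num)]
    nlinarith [sq_nonneg t]
  have hpos : ∀ t ∈ Set.Ioo (1 - 1 / 10 : ℝ) (1 + 1 / 10), t ≠ 0 := by
    rintro t ⟨h₁, h₂⟩
    linarith
  have hx : Continuous fun t : ℝ => √(5 - t ^ 2) := by fun_prop
  have hne : ∀ t : ℝ, 3 - √(5 - t ^ 2) ≠ 0 := fun t => (sub_pos.2 (hupp t)).ne'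
  have hy : ContinuousOn (fun t : ℝ => (3 - √(5 - t ^ 2)) / t)
      (Set.Ioo (1 - 1 / 10) (1 + 1 / 10)) :=
    (continuous_const.sub hx).continuousOn.div continuousOn_id hpos
  have hone : √(5 - 1 ^ 2 : ℝ) = 2 := by
    rw [Real.sqrt_eq_iff_mul_self_eq_of_pos] <;> norm_num
  refine ⟨1 / 10, by norm_num, fun t => √(5 - t ^ 2),
    fun t => 2 * (√(5 - t ^ 2) - 1) / (3 - √(5 - t ^ 2)), fun t => 2 * t / (3 - √(5 - t ^ 2)),
    fun _ => 1, fun t => (3 - √(5 - t ^ 2)) / t,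
    fun t => √(2 - ((3 - √(5 - t ^ 2)) / t) ^ 2), hx.continuousOn, ?_, ?_, continuousOn_const,
    hy, (continuousOn_const.sub (hy.pow 2)).sqrt, hone, ?_, ?_, rfl, ?_, ?_, ?_⟩
  · exact ((continuous_const.mul (hx.sub continuous_const)).div
      (continuous_const.sub hx) hne).continuousOn
  · exact ((continuous_const.mul continuous_id).div (continuous_const.sub hx) hne).continuousOn
  · simp only [hone]; norm_num
  · simp only [hone]; norm_num
  · simp only [hone]; norm_num
  · simp only [hone]; norm_num
  · intro t ht
    have hsq : √(5 - t ^ 2) ^ 2 + t ^ 2 = 5 := by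
      rw [Real.sq_sqrt (by nlinarith [ht.1, ht.2])]
      ring
    have hle : ((3 - √(5 - t ^ 2)) / t) ^ 2 ≤ 2 := by
      have h₁ := ht.1
      rw [div_pow, div_le_iff₀ (by nlinarith)]
      nlinarith [hlow t ht, hupp t]
    exact ⟨hsq, antiparallelogram_pyramid_lengths (hpos t ht) (hne t) hsq rfl
      (Real.sq_sqrt (sub_nonneg.2 hle))⟩
end

section
/- Let A, B, C, D ∈ ℝ³ with B − A = C − D (so ABCD is a parallelogram) and A, B, D affinely independent, and let E ∈ ℝ³ not lie in the affine plane through A, B, D, with dist(E,A) = dist(E,C) and dist(E,B) = dist(E,D). Let A', B', C', D', E' ∈ ℝ³ satisfy the same conditions (B' − A' = C' − D', A', B', D' affinely independent, E' off the plane of A', B', D', dist(E',A') = dist(E',C'), dist(E',B') = dist(E',D')). If dist(A,B) = dist(A',B'), dist(B,C) = dist(B',C'), dist(E,A) = dist(E',A') and dist(E,B) = dist(E',B'), then there exists an isometry f of ℝ³ with f(A) = A', f(B) = B', f(C) = C', f(D) = D', f(E) = E'. -/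
open scoped RealInnerProductSpace

/-- Two finite families of vectors with the same Gram matrix in a finite-dimensional inner product
space differ by a linear isometry. -/
theorem exists_linearIsometryEquiv_of_inner_eq {ι V : Type*} [Fintype ι] [NormedAddCommGroup V]
    [InnerProductSpace ℝ V] [FiniteDimensional ℝ V] {x y : ι → V}
    (h : ∀ i j, ⟪x i, x j⟫ = ⟪y i, y j⟫) : ∃ L : V ≃ₗᵢ[ℝ] V, ∀ i, L (x i) = y i := by
  classical
  let φ := Fintype.linearCombination ℝ x
  let ψ := Fintype.linearCombination ℝ y
  have hnorm (c : ι → ℝ) : ‖ψ c‖ = ‖φ c‖ := by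
    rw [← sq_eq_sq₀ (norm_nonneg _) (norm_nonneg _), ← real_inner_self_eq_norm_sq,
      ← real_inner_self_eq_norm_sq]
    simp only [φ, ψ, Fintype.linearCombination_apply, sum_inner, inner_sum, real_inner_smul_left,
      real_inner_smul_right, h]
  have hker : LinearMap.ker φ ≤ LinearMap.ker ψ := fun c hc ↦ by
    rw [LinearMap.mem_ker] at hc ⊢
    rw [← norm_eq_zero, hnorm, hc, norm_zero]
  let g : LinearMap.range φ →ₗ[ℝ] V :=
    (LinearMap.ker φ).liftQ ψ hker ∘ₗ φ.quotKerEquivRange.symm.toLinearMap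
  have hg (c : ι → ℝ) : g ⟨φ c, c, rfl⟩ = ψ c := by
    have hc : φ.quotKerEquivRange.symm ⟨φ c, c, rfl⟩ = (LinearMap.ker φ).mkQ c :=
      φ.quotKerEquivRange.symm_apply_eq.2 (Subtype.ext rfl)
    simp [g, hc]
  let L : LinearMap.range φ →ₗᵢ[ℝ] V := ⟨g, by rintro ⟨_, c, rfl⟩; rw [hg]; exact hnorm c⟩
  refine ⟨L.extend.toLinearIsometryEquiv rfl, fun i ↦ ?_⟩
  have hφ : φ (Pi.single i 1) = x i := by simp [φ]
  have hψ : ψ (Pi.single i 1) = y i := by simp [ψ]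
  rw [LinearIsometry.coe_toLinearIsometryEquiv, ← hφ, ← hψ, ← hg]
  exact L.extend_apply ⟨φ (Pi.single i 1), _, rfl⟩

/-- The inner products of the vectors from the center of a right pyramid over a parallelogram to two
adjacent base vertices and the apex are determined by the edge lengths. -/
theorem inner_eq_of_rightPyramid {V : Type*} [NormedAddCommGroup V] [InnerProductSpace ℝ V]
    {u v w : V} (hu : ‖w - u‖ = ‖w + u‖) (hv : ‖w - v‖ = ‖w + v‖) :
    ⟪u, w⟫ = 0 ∧ ⟪v, w⟫ = 0 ∧ ⟪u, v⟫ = (‖u + v‖ ^ 2 - ‖u - v‖ ^ 2) / 4 ∧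
      ⟪u, u⟫ = (‖u + v‖ ^ 2 + ‖u - v‖ ^ 2) / 4 + (‖w - u‖ ^ 2 - ‖w - v‖ ^ 2) / 2 ∧
      ⟪v, v⟫ = (‖u + v‖ ^ 2 + ‖u - v‖ ^ 2) / 4 - (‖w - u‖ ^ 2 - ‖w - v‖ ^ 2) / 2 ∧
      ⟪w, w⟫ = (‖w - u‖ ^ 2 + ‖w - v‖ ^ 2) / 2 - (‖u + v‖ ^ 2 + ‖u - v‖ ^ 2) / 4 := by
  have hu' : ‖w - u‖ ^ 2 = ‖w + u‖ ^ 2 := by rw [hu]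
  have hv' : ‖w - v‖ ^ 2 = ‖w + v‖ ^ 2 := by rw [hv]
  simp only [norm_sub_sq_real, norm_add_sq_real, real_inner_self_eq_norm_sq,
    real_inner_comm u w, real_inner_comm v w] at hu' hv' ⊢
  refine ⟨?_, ?_, ?_, ?_, ?_, ?_⟩ <;> linarith

/-- Right pyramids over parallelograms, centered at the origin, are congruent by a linear isometry
if their edge lengths agree. -/
theorem exists_linearIsometryEquiv_of_rightPyramid {V : Type*} [NormedAddCommGroup V]
    [InnerProductSpace ℝ V] [FiniteDimensional ℝ V] {u v w u' v' w' : V}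
    (hu : ‖w - u‖ = ‖w + u‖) (hv : ‖w - v‖ = ‖w + v‖)
    (hu' : ‖w' - u'‖ = ‖w' + u'‖) (hv' : ‖w' - v'‖ = ‖w' + v'‖)
    (h₁ : ‖u - v‖ = ‖u' - v'‖) (h₂ : ‖u + v‖ = ‖u' + v'‖)
    (h₃ : ‖w - u‖ = ‖w' - u'‖) (h₄ : ‖w - v‖ = ‖w' - v'‖) :
    ∃ L : V ≃ₗᵢ[ℝ] V, L u = u' ∧ L v = v' ∧ L w = w' := by
  obtain ⟨huw, hvw, huv, huu, hvv, hww⟩ := inner_eq_of_rightPyramid hu hv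
  obtain ⟨huw', hvw', huv', huu', hvv', hww'⟩ := inner_eq_of_rightPyramid hu' hv'
  rw [← h₁, ← h₂] at huv'
  rw [← h₁, ← h₂, ← h₃, ← h₄] at huu' hvv' hww'
  have hwu := real_inner_comm u w
  have hwv := real_inner_comm v w
  have hvu := real_inner_comm u v
  have hwu' := real_inner_comm u' w'
  have hwv' := real_inner_comm v' w'
  have hvu' := real_inner_comm u' v'
  obtain ⟨L, hL⟩ := exists_linearIsometryEquiv_of_inner_eq (x := ![u, v, w]) (y := ![u', v', w'])
    (fun i j ↦ by fin_cases i <;> fin_cases j <;> dsimp <;> linarith)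
  exact ⟨L, hL 0, hL 1, hL 2⟩


/-- **Uniqueness of right pyramids over a parallelogram.**  Two labelled
quadrangular pyramids whose bases are parallelograms and whose apexes are
equidistant from opposite base vertices, and which share the four edge lengths
`|AB|`, `|BC|`, `|EA|`, `|EB|`, are congruent via an isometry of `ℝ³`. -/
theorem parallelogram_pyramid_congruent
    (A B C D E A' B' C' D' E' : EuclideanSpace ℝ (Fin 3))
    (hpar : B - A = C - D)
    (hind : AffineIndependent ℝ ![A, B, D])
    (hE : E ∉ affineSpan ℝ ({A, B, D} : Set (EuclideanSpace ℝ (Fin 3))))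
    (hEA : dist E A = dist E C) (hEB : dist E B = dist E D)
    (hpar' : B' - A' = C' - D')
    (hind' : AffineIndependent ℝ ![A', B', D'])
    (hE' : E' ∉ affineSpan ℝ ({A', B', D'} : Set (EuclideanSpace ℝ (Fin 3))))
    (hEA' : dist E' A' = dist E' C') (hEB' : dist E' B' = dist E' D')
    (h₁ : dist A B = dist A' B') (h₂ : dist B C = dist B' C')
    (h₃ : dist E A = dist E' A') (h₄ : dist E B = dist E' B') :
    ∃ f : EuclideanSpace ℝ (Fin 3) ≃ᵢ EuclideanSpace ℝ (Fin 3),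
      f A = A' ∧ f B = B' ∧ f C = C' ∧ f D = D' ∧ f E = E' := by
  set O := (2⁻¹ : ℝ) • (A + C) with hO
  set O' := (2⁻¹ : ℝ) • (A' + C') with hO'
  have hC : C - O = -(A - O) := by rw [hO]; module
  have hC' : C' - O' = -(A' - O') := by rw [hO']; module
  have hD : D - O = -(B - O) := by
    rw [eq_add_of_sub_eq hpar, hO]; module
  have hD' : D' - O' = -(B' - O') := by
    rw [eq_add_of_sub_eq hpar', hO']; module
  obtain ⟨L, hLA, hLB, hLE⟩ := exists_linearIsometryEquiv_of_rightPyramid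
    (u := A - O) (v := B - O) (w := E - O) (u' := A' - O') (v' := B' - O') (w' := E' - O')
    (by simpa [← sub_neg_eq_add, ← hC, dist_eq_norm] using hEA)
    (by simpa [← sub_neg_eq_add, ← hD, dist_eq_norm] using hEB)
    (by simpa [← sub_neg_eq_add, ← hC', dist_eq_norm] using hEA')
    (by simpa [← sub_neg_eq_add, ← hD', dist_eq_norm] using hEB')
    (by simpa [dist_eq_norm] using h₁)
    (by
      rw [add_comm, add_comm (A' - O')]
      simpa [← sub_neg_eq_add, ← hC, ← hC', dist_eq_norm] using h₂)
    (by simpa [dist_eq_norm] using h₃)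
    (by simpa [dist_eq_norm] using h₄)
  refine ⟨((IsometryEquiv.subRight O).trans L.toIsometryEquiv).trans (IsometryEquiv.addRight O'),
    ?_, ?_, ?_, ?_, ?_⟩ <;>
    simp only [IsometryEquiv.trans_apply, IsometryEquiv.subRight_apply,
      IsometryEquiv.addRight_apply, LinearIsometryEquiv.coe_toIsometryEquiv]
  · rw [hLA, sub_add_cancel]
  · rw [hLB, sub_add_cancel]
  · rw [hC, map_neg, hLA, ← hC', sub_add_cancel]
  · rw [hD, map_neg, hLB, ← hD', sub_add_cancel]
  · rw [hLE, sub_add_cancel]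
end

section
/- Let a₂, b₂ be real numbers with b₂ > 0 and a₂² − 2a₂ + b₂² > 0, and define a₁ = (a₂³ − a₂² + a₂·b₂² + b₂²)/(a₂² + b₂²) and b₁ = b₂·(a₂² − 2a₂ + b₂²)/(a₂² + b₂²). Set A = (0,0), B = (1,0), C = (a₂,b₂), D = (a₁,b₁) in ℝ². Then the affine function g(x,y) = (a₂ − 1)·y − b₂·x + b₂, which vanishes exactly on the line through B and C, satisfies g(A) = b₂ > 0 and g(D) = −b₂·(a₂² − 2a₂ + b₂²)/(a₂² + b₂²) < 0; hence A and D lie strictly on opposite sides of the line through B and C, and the segment [A,D] meets that line. In particular the segments [A,D] and [B,C] of the quadrilateral ABCD intersect, so the quadrilateral self-intersects. -/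
/-- **The second elimination branch self-intersects.**  With
`a₁ = (a₂³ − a₂² + a₂b₂² + b₂²)/(a₂² + b₂²)`,
`b₁ = b₂(a₂² − 2a₂ + b₂²)/(a₂² + b₂²)`, `b₂ > 0` and `a₂² − 2a₂ + b₂² > 0`, the
affine function `g(x,y) = (a₂−1)y − b₂x + b₂` vanishing on the line `BC`
satisfies `g(A) = b₂ > 0` and `g(D) < 0`, so the segment `[A,D]` meets the line
`BC`; moreover the segments `[A,D]` and `[B,C]` intersect: the quadrilateral
`ABCD` self-intersects. -/
theorem second_branch_selfintersecting
    (a₂ b₂ : ℝ) (hb₂ : 0 < b₂) (hpos : 0 < a₂ ^ 2 - 2 * a₂ + b₂ ^ 2)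
    (a₁ b₁ : ℝ)
    (ha₁ : a₁ = (a₂ ^ 3 - a₂ ^ 2 + a₂ * b₂ ^ 2 + b₂ ^ 2) / (a₂ ^ 2 + b₂ ^ 2))
    (hb₁ : b₁ = b₂ * (a₂ ^ 2 - 2 * a₂ + b₂ ^ 2) / (a₂ ^ 2 + b₂ ^ 2)) :
    let A : ℝ × ℝ := (0, 0); let B : ℝ × ℝ := (1, 0)
    let C : ℝ × ℝ := (a₂, b₂); let D : ℝ × ℝ := (a₁, b₁)
    let g : ℝ × ℝ → ℝ := fun p => (a₂ - 1) * p.2 - b₂ * p.1 + b₂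
    g A = b₂ ∧ 0 < g A ∧
    g D = -(b₂ * (a₂ ^ 2 - 2 * a₂ + b₂ ^ 2)) / (a₂ ^ 2 + b₂ ^ 2) ∧ g D < 0 ∧
    (∃ p ∈ segment ℝ A D, g p = 0) ∧
    (segment ℝ A D ∩ segment ℝ B C).Nonempty := by
  intro A B C D g
  have hS : 0 < a₂ ^ 2 + b₂ ^ 2 := by positivity
  have hT : 0 < (a₂ ^ 2 + b₂ ^ 2) + (a₂ ^ 2 - 2 * a₂ + b₂ ^ 2) := add_pos hS hpos
  have hS' := hS.ne'
  have hT' := hT.ne'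
  have hgA : g A = b₂ := by simp [g, A]
  have hgD : g D = -(b₂ * (a₂ ^ 2 - 2 * a₂ + b₂ ^ 2)) / (a₂ ^ 2 + b₂ ^ 2) := by
    simp only [g, D, ha₁, hb₁]
    field_simp
    ring
  set S := a₂ ^ 2 + b₂ ^ 2 with hSdef
  set Q := a₂ ^ 2 - 2 * a₂ + b₂ ^ 2 with hQdef
  have hsum : S / (S + Q) + Q / (S + Q) = 1 := by rw [← add_div, div_self hT']
  have hBC : ((S + Q * a₂) / (S + Q), b₂ * Q / (S + Q)) ∈ segment ℝ B C := by
    refine ⟨S / (S + Q), Q / (S + Q), by positivity, by positivity, hsum, ?_⟩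
    ext <;> simp [B, C] <;> ring
  have hAD : ((S + Q * a₂) / (S + Q), b₂ * Q / (S + Q)) ∈ segment ℝ A D := by
    refine ⟨Q / (S + Q), S / (S + Q), by positivity, by positivity, by rw [add_comm, hsum], ?_⟩
    ext
    · simp only [A, D, ha₁, Prod.fst_add, Prod.smul_fst, smul_eq_mul, mul_zero, zero_add]
      field_simp
      rw [hSdef, hQdef]
      ring
    · simp only [A, D, hb₁, Prod.snd_add, Prod.smul_snd, smul_eq_mul, mul_zero, zero_add]
      field_simp
  refine ⟨hgA, hgA ▸ hb₂, hgD, ?_, ⟨_, hAD, ?_⟩, ⟨_, hAD, hBC⟩⟩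
  · rw [hgD]
    exact div_neg_of_neg_of_pos (neg_neg_of_pos (mul_pos hb₂ hpos)) hS
  · simp only [g]
    field_simp
    ring
end
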